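/- arXiv:1510.06813 — 2 statements merged into one kernel-verified Lean document; each statement's English description precedes it below -/
import Mathlib

section
/- Let A be a separable metric space, and let B, C be complete separable metric spaces. For each n let y_n : A^n → B^n be measurable, and let π_A, π_B, π_C be Borel probability measures on A, B, C respectively. Suppose that for every ε > 0 and all sufficiently large n, π_A^n({a ∈ A^n : ρ_B(ε(y_n(a)), π_B) < ε}) > 1 − ε. Then for every ε > 0 and all sufficiently large n, (π_A × π_C)^n({(a,c) : ρ_{B×C}(ε(y_n(a), c), π_B × π_C) < ε}) > 1 − ε, where ε(y_n(a), c) is the empirical measure of the n pairs ((y_n(a))_m, c_m). -/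
open MeasureTheory Filter Topology
open scoped ENNReal

/-- The empirical measure of the samples `a : Fin n → A`. -/
noncomputable def empMeasure {A : Type*} [MeasurableSpace A] {n : ℕ} (a : Fin n → A) :
    Measure A := (n : ℝ≥0∞)⁻¹ • ∑ m : Fin n, Measure.dirac (a m)

lemma emp_prob {X : Type*} [MeasurableSpace X] {n : ℕ} (hn : 0 < n) (x : Fin n → X) :
    IsProbabilityMeasure (empMeasure x) := by
  constructor
  simp only [empMeasure, Measure.smul_apply, Measure.coe_finset_sum, Finset.sum_apply,
    measure_univ, Finset.sum_const, Finset.card_univ, Fintype.card_fin, smul_eq_mul, nsmul_eq_mul,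
    mul_one]
  exact ENNReal.inv_mul_cancel (by exact_mod_cast hn.ne') (ENNReal.natCast_ne_top n)

lemma emp_real {X : Type*} [MeasurableSpace X] {n : ℕ} (x : Fin n → X) {S : Set X}
    (hS : MeasurableSet S) :
    (empMeasure x).real S = (n : ℝ)⁻¹ * ∑ m, S.indicator (fun _ => (1 : ℝ)) (x m) := by
  simp only [empMeasure, Measure.real, Measure.smul_apply, Measure.coe_finset_sum,
    Finset.sum_apply, smul_eq_mul, ENNReal.toReal_mul, ENNReal.toReal_inv, ENNReal.toReal_natCast]
  congr 1
  rw [ENNReal.toReal_sum (fun _ _ => measure_ne_top _ _)]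
  refine Finset.sum_congr rfl fun m _ => ?_
  rw [Measure.dirac_apply' _ hS]
  by_cases h : x m ∈ S <;> simp [h]

lemma emp_lip {X : Type*} [PseudoMetricSpace X] [MeasurableSpace X] [OpensMeasurableSpace X]
    {n : ℕ} (hn : 0 < n) (x x' : Fin n → X) :
    levyProkhorovDist (empMeasure x) (empMeasure x') ≤ dist x x' := by
  have := emp_prob hn x
  have := emp_prob hn x'
  refine levyProkhorovDist_le_of_forall_le _ _ dist_nonneg fun ε S hε hS => ?_
  refine le_add_right ?_
  rw [← ENNReal.toReal_le_toReal (measure_ne_top _ _) (measure_ne_top _ _)]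
  change (empMeasure x).real S ≤ (empMeasure x').real (Metric.thickening ε S)
  rw [emp_real x hS,
    emp_real x' Metric.isOpen_thickening.measurableSet]
  gcongr with m
  by_cases h : x m ∈ S
  · have : x' m ∈ Metric.thickening ε S := by
      rw [Metric.mem_thickening_iff]
      exact ⟨x m, h, by rw [dist_comm]; exact (dist_le_pi_dist x x' m).trans_lt hε⟩
    simp [h, this]
  · simp only [h, not_false_eq_true, Set.indicator_of_notMem]
    exact Set.indicator_nonneg (fun _ _ => zero_le_one) _

lemma emp_cont {X : Type*} [PseudoMetricSpace X] [MeasurableSpace X] [OpensMeasurableSpace X]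
    {n : ℕ} (hn : 0 < n) (ν : Measure X) [IsProbabilityMeasure ν] :
    Continuous (fun x : Fin n → X => levyProkhorovDist (empMeasure x) ν) := by
  have := fun x : Fin n → X => emp_prob hn x
  refine LipschitzWith.continuous (K := 1) (LipschitzWith.of_le_add fun x x' => ?_)
  have := levyProkhorovDist_triangle (empMeasure x) (empMeasure x') ν
  have := emp_lip hn x x'
  linarith

lemma lp_prod {B C : Type*} [PseudoMetricSpace B] [MeasurableSpace B] [OpensMeasurableSpace B]
    [PseudoMetricSpace C] [MeasurableSpace C] [OpensMeasurableSpace (B × C)]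
    (μ ν : Measure B) (κ : Measure C) [IsProbabilityMeasure μ] [IsProbabilityMeasure ν]
    [IsProbabilityMeasure κ] :
    levyProkhorovDist (μ.prod κ) (ν.prod κ) ≤ levyProkhorovDist μ ν := by
  refine levyProkhorovDist_le_of_forall_le _ _ ENNReal.toReal_nonneg fun ε S hε hS => ?_
  have hε0 : 0 < ε := ENNReal.toReal_nonneg.trans_lt hε
  rw [Measure.prod_apply_symm hS, Measure.prod_apply_symm Metric.isOpen_thickening.measurableSet]
  calc _ ≤ ∫⁻ c, (ν ((fun b => (b, c)) ⁻¹' Metric.thickening ε S) + ENNReal.ofReal ε) ∂κ := by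
        refine lintegral_mono fun c => ?_
        have h1 : levyProkhorovEDist μ ν < ENNReal.ofReal ε :=
          (ENNReal.lt_ofReal_iff_toReal_lt (levyProkhorovEDist_ne_top μ ν)).2 hε
        have h2 := left_measure_le_of_levyProkhorovEDist_lt h1
          (B := (fun b => (b, c)) ⁻¹' S) (hS.preimage (by fun_prop))
        rw [ENNReal.toReal_ofReal hε0.le] at h2
        refine h2.trans ?_
        gcongr
        intro b hb
        rw [Metric.mem_thickening_iff] at hb
        obtain ⟨z, hz, hd⟩ := hb
        refine Metric.mem_thickening_iff.2 ⟨(z, c), hz, ?_⟩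
        simpa [Prod.dist_eq, hε0] using hd
    _ = _ := by
        rw [lintegral_add_right _ measurable_const]; simp

lemma exists_cover {X : Type*} [PseudoMetricSpace X] [TopologicalSpace.SeparableSpace X]
    [MeasurableSpace X] [OpensMeasurableSpace X] (π : Measure X) [IsProbabilityMeasure π]
    {δ : ℝ} (hδ : 0 < δ) :
    ∃ (K : ℕ) (E : Fin K → Set X) (U : Set X), (∀ i, MeasurableSet (E i)) ∧
      Pairwise (Function.onFun Disjoint E) ∧ (∀ i, ∀ x ∈ E i, ∀ x' ∈ E i, dist x x' < 4 * δ) ∧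
      MeasurableSet U ∧ 1 - δ < π.real U ∧ Metric.thickening δ U ⊆ ⋃ i, E i := by
  have : Nonempty X := π.nonempty_of_neZero
  let d := TopologicalSpace.denseSeq X
  let V : ℕ → Set X := fun k => ⋃ i < k, Metric.ball (d i) δ
  have hVm : Monotone V := fun k l hkl => Set.biUnion_subset_biUnion_left
    (fun i (hi : i < k) => lt_of_lt_of_le hi hkl)
  have hV : ⋃ k, V k = Set.univ := by
    refine Set.eq_univ_of_forall fun x => ?_
    obtain ⟨i, hi⟩ := (TopologicalSpace.denseRange_denseSeq X).exists_dist_lt x hδ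
    exact Set.mem_iUnion.2 ⟨i + 1, Set.mem_iUnion₂.2 ⟨i, Nat.lt_succ_self i, hi⟩⟩
  have ht := tendsto_measure_iUnion_atTop (μ := π) hVm
  rw [hV, measure_univ] at ht
  have ht' := (ENNReal.tendsto_toReal ENNReal.one_ne_top).comp ht
  obtain ⟨K, hK⟩ := (ht'.eventually_const_lt (show 1 - δ < (1 : ℝ≥0∞).toReal by simpa)).exists
  let W : ℕ → Set X := fun i => Metric.ball (d i) (2 * δ)
  refine ⟨K, fun i => disjointed W i, V K, ?_, ?_, ?_, ?_, hK, ?_⟩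
  · exact fun i => MeasurableSet.disjointed (fun _ => Metric.isOpen_ball.measurableSet) _
  · exact fun i j hij => disjoint_disjointed W (fun h => hij (Fin.ext h))
  · intro i x hx x' hx'
    have h1 : dist x (d i) < 2 * δ := disjointed_subset W i hx
    have h2 : dist x' (d i) < 2 * δ := disjointed_subset W i hx'
    have := dist_triangle_right x x' (d i)
    linarith
  · exact MeasurableSet.iUnion fun i => MeasurableSet.iUnion fun _ =>
      Metric.isOpen_ball.measurableSet
  · intro x hx
    obtain ⟨z, hz, hd⟩ := Metric.mem_thickening_iff.1 hx
    obtain ⟨i, hi, hzi⟩ := Set.mem_iUnion₂.1 hz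
    have hxi : x ∈ W i := by
      have := dist_triangle x z (d i)
      have h3 : dist z (d i) < δ := hzi
      change dist x (d i) < 2 * δ
      linarith
    classical
    have hex : ∃ j, x ∈ W j := ⟨i, hxi⟩
    refine Set.mem_iUnion.2 ⟨⟨Nat.find hex, (Nat.find_min' hex hxi).trans_lt hi⟩, ?_⟩
    change x ∈ disjointed W (Nat.find hex)
    rw [disjointed_eq_inter_compl]
    refine ⟨Nat.find_spec hex, ?_⟩
    simp only [Set.mem_iInter]
    exact fun j hj => Nat.find_min hex hj

lemma det {B C : Type*} [PseudoMetricSpace B] [MeasurableSpace B]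
    [PseudoMetricSpace C] [MeasurableSpace C] [OpensMeasurableSpace (B × C)]
    (μ : Measure B) (κ : Measure C) (ν : Measure (B × C)) [IsProbabilityMeasure μ]
    [IsProbabilityMeasure ν] [IsProbabilityMeasure κ] {K L : ℕ}
    (E : Fin K → Set B) (F : Fin L → Set C) (hE : ∀ i, MeasurableSet (E i))
    (hF : ∀ i, MeasurableSet (F i)) (dE : Pairwise (Function.onFun Disjoint E))
    (dF : Pairwise (Function.onFun Disjoint F)) {δ η : ℝ} (hδ : 0 < δ) (hη : 0 ≤ η)
    (hKL : K * L * η ≤ δ)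
    (sE : ∀ i, ∀ x ∈ E i, ∀ x' ∈ E i, dist x x' < 4 * δ)
    (sF : ∀ i, ∀ x ∈ F i, ∀ x' ∈ F i, dist x x' < 4 * δ)
    (mE : μ.real (⋃ i, E i)ᶜ ≤ 2 * δ) (mF : κ.real (⋃ i, F i)ᶜ ≤ δ)
    (hdev : ∀ i j, |ν.real (E i ×ˢ F j) - μ.real (E i) * κ.real (F j)| < η) :
    levyProkhorovDist ν (μ.prod κ) ≤ 4 * δ := by
  rw [levyProkhorovDist_comm]
  refine levyProkhorovDist_le_of_forall_le _ _ (by positivity) fun ε S hε hS => ?_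
  have hε0 : 0 < ε := by linarith
  classical
  let R : Fin K × Fin L → Set (B × C) := fun p => E p.1 ×ˢ F p.2
  have hR : ∀ p, MeasurableSet (R p) := fun p => (hE _).prod (hF _)
  have dR : Pairwise (Function.onFun Disjoint R) := by
    intro p q hpq
    refine Set.disjoint_prod.2 ?_
    by_cases h : p.1 = q.1
    · exact Or.inr (dF fun h' => hpq (Prod.ext h h'))
    · exact Or.inl (dE h)
  let I : Finset (Fin K × Fin L) := Finset.univ.filter fun p => (R p ∩ S).Nonempty
  have hsub : S ⊆ ((⋃ p ∈ I, R p) ∪ (⋃ i, E i)ᶜ ×ˢ Set.univ) ∪ Set.univ ×ˢ (⋃ i, F i)ᶜ := by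
    rintro ⟨b, c⟩ hbc
    by_cases h1 : b ∈ ⋃ i, E i
    · by_cases h2 : c ∈ ⋃ i, F i
      · left; left
        obtain ⟨i, hi⟩ := Set.mem_iUnion.1 h1
        obtain ⟨j, hj⟩ := Set.mem_iUnion.1 h2
        refine Set.mem_iUnion₂.2 ⟨(i, j), ?_, ⟨hi, hj⟩⟩
        simp only [I, Finset.mem_filter, Finset.mem_univ, true_and]
        exact ⟨(b, c), ⟨hi, hj⟩, hbc⟩
      · right; exact ⟨trivial, h2⟩
    · left; right; exact ⟨h1, trivial⟩
  have hth : (⋃ p ∈ I, R p) ⊆ Metric.thickening ε S := by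
    intro z hz
    obtain ⟨p, hp, hzp⟩ := Set.mem_iUnion₂.1 hz
    simp only [I, Finset.mem_filter, Finset.mem_univ, true_and] at hp
    obtain ⟨w, hw, hwS⟩ := hp
    refine Metric.mem_thickening_iff.2 ⟨w, hwS, ?_⟩
    rw [Prod.dist_eq]
    exact max_lt ((sE _ _ hzp.1 _ hw.1).trans hε) ((sF _ _ hzp.2 _ hw.2).trans hε)
  have key : (μ.prod κ).real S ≤ ν.real (Metric.thickening ε S) + ε := by
    have h1 : (μ.prod κ).real S ≤ (μ.prod κ).real (⋃ p ∈ I, R p) + 2 * δ + δ := by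
      refine (measureReal_mono hsub).trans ((measureReal_union_le _ _).trans ?_)
      gcongr
      · refine (measureReal_union_le _ _).trans ?_
        gcongr
        rw [measureReal_prod_prod]; simpa using mE
      · rw [measureReal_prod_prod]; simpa using mF
    have h2 : (μ.prod κ).real (⋃ p ∈ I, R p) ≤ ν.real (⋃ p ∈ I, R p) + K * L * η := by
      rw [measureReal_biUnion_finset (fun p _ q _ h => dR h) (fun p _ => hR p),
        measureReal_biUnion_finset (fun p _ q _ h => dR h) (fun p _ => hR p)]
      have : ∑ p ∈ I, (μ.prod κ).real (R p) ≤ ∑ p ∈ I, (ν.real (R p) + η) := by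
        refine Finset.sum_le_sum fun p _ => ?_
        have := (abs_lt.1 (hdev p.1 p.2)).1
        simp only [R]
        rw [measureReal_prod_prod]; linarith
      rw [Finset.sum_add_distrib, Finset.sum_const, nsmul_eq_mul] at this
      have hc : (I.card : ℝ) ≤ K * L := by
        have := Finset.card_le_univ I
        simp at this
        exact_mod_cast this
      nlinarith
    have h3 := measureReal_mono (μ := ν) hth
    linarith
  rw [← ENNReal.ofReal_toReal (measure_ne_top (μ.prod κ) S),
    ← ENNReal.ofReal_toReal (measure_ne_top ν (Metric.thickening ε S)),
    ← ENNReal.ofReal_add ENNReal.toReal_nonneg hε0.le]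
  exact ENNReal.ofReal_le_ofReal key

lemma conc {B C : Type*} [MeasurableSpace B] [MeasurableSpace C] {n : ℕ} (hn : 0 < n)
    (π : Measure C) [IsProbabilityMeasure π] (b : Fin n → B) {E : Set B} {F : Set C}
    (hE : MeasurableSet E) (hF : MeasurableSet F) {η : ℝ} (hη : 0 < η) :
    (Measure.pi fun _ : Fin n => π) {c | η ≤ |(empMeasure (fun m => (b m, c m))).real (E ×ˢ F)
      - (empMeasure b).real E * π.real F|} ≤ ENNReal.ofReal (1 / (n * η ^ 2)) := by
  have hn' : (0 : ℝ) < n := by exact_mod_cast hn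
  let e : Fin n → ℝ := fun m => E.indicator (fun _ => (1 : ℝ)) (b m)
  have he : ∀ m, e m ∈ Set.Icc (0 : ℝ) 1 := fun m => by
    by_cases h : b m ∈ E <;> simp [e, h]
  let X : Fin n → C → ℝ := fun m c => e m * F.indicator (fun _ => (1 : ℝ)) c
  have hXm : ∀ m, Measurable (X m) := fun m =>
    (measurable_const.indicator hF).const_mul _
  have hXb : ∀ m c, X m c ∈ Set.Icc (0 : ℝ) 1 := fun m c => by
    by_cases h : c ∈ F
    · simpa [X, h] using he m
    · simp [X, h]
  have hXL : ∀ m, MemLp (X m) 2 π := fun m =>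
    memLp_of_bounded (Eventually.of_forall (hXb m)) (hXm m).aestronglyMeasurable 2
  have hSL : MemLp (∑ m, fun c : Fin n → C => X m (c m)) 2 (Measure.pi fun _ : Fin n => π) :=
    memLp_finset_sum' _ fun m _ =>
      (hXL m).comp_measurePreserving (measurePreserving_eval (fun _ : Fin n => π) m)
  have hvar : ProbabilityTheory.variance (∑ m, fun c : Fin n → C => X m (c m))
      (Measure.pi fun _ : Fin n => π) ≤ n := by
    rw [ProbabilityTheory.variance_sum_pi hXL]
    calc _ ≤ ∑ m : Fin n, (1 : ℝ) := by
          refine Finset.sum_le_sum fun m _ => ?_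
          refine (ProbabilityTheory.variance_le_sq_of_bounded
            (Eventually.of_forall (hXb m)) (hXm m).aemeasurable).trans ?_
          norm_num
      _ = n := by simp
  have hmean : ∫ c, (∑ m, fun c : Fin n → C => X m (c m)) c ∂(Measure.pi fun _ : Fin n => π)
      = ∑ m, e m * π.real F := by
    simp only [Finset.sum_apply]
    rw [integral_finset_sum]
    · refine Finset.sum_congr rfl fun m _ => ?_
      rw [integral_comp_eval (μ := fun _ : Fin n => π) (i := m) (hXm m).aestronglyMeasurable]
      simp only [X]
      rw [integral_const_mul, integral_indicator_const _ hF]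
      simp
    · exact fun m _ => ((hXL m).comp_measurePreserving
        (measurePreserving_eval (fun _ : Fin n => π) m)).integrable (by norm_num)
  have hch := ProbabilityTheory.meas_ge_le_variance_div_sq hSL (c := n * η) (by positivity)
  rw [hmean] at hch
  refine (measure_mono ?_).trans (hch.trans (ENNReal.ofReal_le_ofReal ?_))
  · intro c hc
    simp only [Set.mem_setOf_eq] at hc ⊢
    rw [emp_real _ (hE.prod hF), emp_real _ hE] at hc
    have h1 : ∀ m, (E ×ˢ F).indicator (fun _ => (1 : ℝ)) (b m, c m) = X m (c m) := fun m => by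
      by_cases h : b m ∈ E <;> by_cases h' : c m ∈ F <;> simp [X, e, h, h']
    simp only [h1] at hc
    rw [mul_assoc, ← mul_sub, abs_mul, abs_of_pos (inv_pos.2 hn'), le_inv_mul_iff₀ hn',
      Finset.sum_mul] at hc
    simpa using hc
  · calc _ ≤ (n : ℝ) / (n * η) ^ 2 := by gcongr
      _ = _ := by field_simp

/-- If the empirical measures `ε(y_n(a))` converge to `π_B` in probability, then the joint
empirical measures `ε(y_n(a), c)` of the pairs `((y_n(a))_m, c_m)`, where the `c_m` are
i.i.d. samples from `π_C` independent of `a`, converge in probability to `π_B × π_C`. -/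
theorem stmt_6 {A B C : Type*}
    [MetricSpace A] [TopologicalSpace.SeparableSpace A] [MeasurableSpace A] [BorelSpace A]
    [MetricSpace B] [CompleteSpace B] [TopologicalSpace.SeparableSpace B]
    [MeasurableSpace B] [BorelSpace B]
    [MetricSpace C] [CompleteSpace C] [TopologicalSpace.SeparableSpace C]
    [MeasurableSpace C] [BorelSpace C]
    (y : (n : ℕ) → (Fin n → A) → (Fin n → B)) (hy : ∀ n, Measurable (y n))
    (πA : Measure A) (πB : Measure B) (πC : Measure C)
    [IsProbabilityMeasure πA] [IsProbabilityMeasure πB] [IsProbabilityMeasure πC]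
    (h : ∀ ε > (0 : ℝ), ∃ N : ℕ, ∀ n ≥ N,
      ((Measure.pi fun _ : Fin n => πA)
        {a : Fin n → A | levyProkhorovDist (empMeasure (y n a)) πB < ε}).toReal > 1 - ε) :
    ∀ ε > (0 : ℝ), ∃ N : ℕ, ∀ n ≥ N,
      ((Measure.pi fun _ : Fin n => πA.prod πC)
        {ac : Fin n → A × C |
          levyProkhorovDist
            (empMeasure (fun m : Fin n => ((y n fun m' => (ac m').1) m, (ac m).2)))
            (πB.prod πC) < ε}).toReal > 1 - ε := by
  intro ε hε
  have : SecondCountableTopology B := UniformSpace.secondCountable_of_separable B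
  have : SecondCountableTopology C := UniformSpace.secondCountable_of_separable C
  obtain ⟨δ, hδ, hδε⟩ : ∃ δ : ℝ, 0 < δ ∧ 6 * δ = ε := ⟨ε / 6, by positivity, by ring⟩
  obtain ⟨K, E, U, hE, dE, sE, hU, mU, tU⟩ := exists_cover πB hδ
  obtain ⟨L, F, V, hF, dF, sF, hV, mV, tV⟩ := exists_cover πC hδ
  obtain ⟨η, hη, hKL⟩ : ∃ η : ℝ, 0 < η ∧ K * L * η ≤ δ := by
    refine ⟨δ / (K * L + 1), by positivity, ?_⟩
    rw [mul_div_assoc', div_le_iff₀ (by positivity)]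
    nlinarith
  have mF : πC.real (⋃ i, F i)ᶜ ≤ δ := by
    have h1 : V ⊆ ⋃ i, F i := (Metric.self_subset_thickening hδ V).trans tV
    have h2 := measureReal_mono (μ := πC) h1
    rw [probReal_compl_eq_one_sub (MeasurableSet.iUnion hF)]
    linarith
  obtain ⟨N₁, hN₁⟩ := h δ hδ
  obtain ⟨N₂, hN₂⟩ := exists_nat_gt (K * L / (δ * η ^ 2))
  refine ⟨max N₁ (N₂ + 1), fun n hn => ?_⟩
  have hnN₁ : N₁ ≤ n := (le_max_left _ _).trans hn
  have hnN₂ : N₂ + 1 ≤ n := (le_max_right _ _).trans hn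
  have hn0 : 0 < n := by omega
  have hn0' : (0 : ℝ) < n := by exact_mod_cast hn0
  have hnR : K * L * (1 / (n * η ^ 2)) ≤ δ := by
    have h1 : K * L / (δ * η ^ 2) < n := hN₂.trans_le (by exact_mod_cast (by omega : N₂ ≤ n))
    rw [div_lt_iff₀ (by positivity)] at h1
    rw [mul_one_div, div_le_iff₀ (by positivity)]
    linarith
  have hA := hN₁ n hnN₁
  have hmp := measurePreserving_arrowProdEquivProdArrow A C (Fin n) (fun _ => πA) (fun _ => πC)
  set PA := Measure.pi fun _ : Fin n => πA with hPA
  set PC := Measure.pi fun _ : Fin n => πC with hPC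
  let G : Set ((Fin n → A) × (Fin n → C)) := {ac | levyProkhorovDist
    (empMeasure (fun m : Fin n => (y n ac.1 m, ac.2 m))) (πB.prod πC) < ε}
  have hyn := hy n
  have hGm : MeasurableSet G := by
    have h1 : Measurable (fun x : Fin n → B × C =>
      levyProkhorovDist (empMeasure x) (πB.prod πC)) := (emp_cont hn0 _).measurable
    have h2 : Measurable (fun ac : (Fin n → A) × (Fin n → C) =>
        (fun m : Fin n => (y n ac.1 m, ac.2 m))) := by
      refine measurable_pi_lambda _ fun m => ?_
      exact ((measurable_pi_apply m).comp (hyn.comp measurable_fst)).prodMk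
        ((measurable_pi_apply m).comp measurable_snd)
    exact measurableSet_lt (h1.comp h2) measurable_const
  have hgoal : (Measure.pi fun _ : Fin n => πA.prod πC)
        {ac : Fin n → A × C |
          levyProkhorovDist
            (empMeasure (fun m : Fin n => ((y n fun m' => (ac m').1) m, (ac m).2)))
            (πB.prod πC) < ε} = (PA.prod PC) G := by
    rw [← hmp.measure_preimage hGm.nullMeasurableSet]
    rfl
  rw [hgoal]
  let G₁ : Set (Fin n → A) := {a | levyProkhorovDist (empMeasure (y n a)) πB < δ}
  have hG₁m : MeasurableSet G₁ :=
    measurableSet_lt ((emp_cont hn0 πB).measurable.comp hyn) measurable_const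
  let D : Fin K × Fin L → Set ((Fin n → A) × (Fin n → C)) := fun p =>
    {ac | η ≤ |(empMeasure (fun m => (y n ac.1 m, ac.2 m))).real (E p.1 ×ˢ F p.2)
      - (empMeasure (y n ac.1)).real (E p.1) * πC.real (F p.2)|}
  have hDm : ∀ p, MeasurableSet (D p) := by
    intro p
    refine measurableSet_le measurable_const ?_
    simp only [emp_real _ ((hE p.1).prod (hF p.2)), emp_real _ (hE p.1)]
    have h1 : ∀ m, Measurable (fun ac : (Fin n → A) × (Fin n → C) => y n ac.1 m) := fun m =>
      (measurable_pi_apply m).comp (hyn.comp measurable_fst)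
    have h2 : ∀ m, Measurable (fun ac : (Fin n → A) × (Fin n → C) => ac.2 m) := fun m =>
      (measurable_pi_apply m).comp measurable_snd
    have h3 : ∀ m, Measurable (fun ac : (Fin n → A) × (Fin n → C) =>
        (E p.1 ×ˢ F p.2).indicator (fun _ => (1 : ℝ)) (y n ac.1 m, ac.2 m)) := fun m =>
      (measurable_const.indicator ((hE p.1).prod (hF p.2))).comp ((h1 m).prodMk (h2 m))
    have h4 : ∀ m, Measurable (fun ac : (Fin n → A) × (Fin n → C) =>
        (E p.1).indicator (fun _ => (1 : ℝ)) (y n ac.1 m)) := fun m =>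
      (measurable_const.indicator (hE p.1)).comp (h1 m)
    have h5 := (((Finset.measurable_sum Finset.univ fun m _ => h3 m).const_mul (n : ℝ)⁻¹).sub
      (((Finset.measurable_sum Finset.univ fun m _ => h4 m).const_mul (n : ℝ)⁻¹).mul_const
        (πC.real (F p.2)))).norm
    simpa only [Real.norm_eq_abs, Pi.sub_apply] using h5
  have hD : ∀ p, (PA.prod PC).real (D p) ≤ 1 / (n * η ^ 2) := by
    intro p
    refine ENNReal.toReal_le_of_le_ofReal (by positivity) ?_
    rw [Measure.prod_apply (hDm p)]
    calc _ ≤ ∫⁻ a, ENNReal.ofReal (1 / (n * η ^ 2)) ∂PA :=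
          lintegral_mono fun a => conc hn0 πC (y n a) (hE p.1) (hF p.2) hη
      _ = _ := by simp
  have hsub : Gᶜ ⊆ G₁ᶜ ×ˢ Set.univ ∪ ⋃ p, D p := by
    intro ac hac
    by_contra hcon
    apply hac
    simp only [Set.mem_union, Set.mem_prod, Set.mem_compl_iff, Set.mem_univ, and_true,
      Set.mem_iUnion, not_or, not_not, not_exists] at hcon
    obtain ⟨c1, c2⟩ := hcon
    have := emp_prob hn0 (y n ac.1)
    have := emp_prob hn0 (fun m => (y n ac.1 m, ac.2 m))
    have c1' : levyProkhorovDist (empMeasure (y n ac.1)) πB < δ := c1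
    have mE : (empMeasure (y n ac.1)).real (⋃ i, E i)ᶜ ≤ 2 * δ := by
      rw [probReal_compl_eq_one_sub (MeasurableSet.iUnion hE)]
      have h1 : levyProkhorovEDist (empMeasure (y n ac.1)) πB < ENNReal.ofReal δ :=
        (ENNReal.lt_ofReal_iff_toReal_lt (levyProkhorovEDist_ne_top _ _)).2 c1'
      have h2 := right_measure_le_of_levyProkhorovEDist_lt h1 hU
      rw [ENNReal.toReal_ofReal hδ.le] at h2
      have h3 := ENNReal.toReal_mono (by simp) h2
      rw [ENNReal.toReal_add (by simp) (by simp), ENNReal.toReal_ofReal hδ.le] at h3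
      have h4 := measureReal_mono (μ := empMeasure (y n ac.1)) tU
      simp only [Measure.real] at *
      linarith
    have h1 := det (empMeasure (y n ac.1)) πC (empMeasure (fun m => (y n ac.1 m, ac.2 m)))
      E F hE hF dE dF hδ hη.le hKL sE sF mE mF (fun i j => not_le.1 (c2 (i, j)))
    have h2 := lp_prod (empMeasure (y n ac.1)) πB πC
    have h3 := levyProkhorovDist_triangle (empMeasure (fun m => (y n ac.1 m, ac.2 m)))
      ((empMeasure (y n ac.1)).prod πC) (πB.prod πC)
    change _ < ε
    linarith
  have hb : (PA.prod PC).real Gᶜ ≤ 2 * δ := by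
    refine (measureReal_mono hsub).trans ((measureReal_union_le _ _).trans ?_)
    have h1 : (PA.prod PC).real (G₁ᶜ ×ˢ Set.univ) ≤ δ := by
      rw [measureReal_prod_prod, probReal_compl_eq_one_sub hG₁m]
      simp only [probReal_univ, mul_one]
      change PA.real G₁ > 1 - δ at hA
      linarith
    have h2 : (PA.prod PC).real (⋃ p, D p) ≤ δ := by
      refine (measureReal_iUnion_fintype_le _).trans
        ((Finset.sum_le_sum fun p _ => hD p).trans ?_)
      simpa using hnR
    linarith
  rw [probReal_compl_eq_one_sub hGm] at hb
  change (PA.prod PC).real G > 1 - ε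
  linarith
end

section
/- Let A, B, C, D be separable metric spaces with Borel probability measures π_A, π_B, π_C on A, B, C. For each n let y_n : A^n → B^n be measurable, and let z : B × C → D be measurable and 'probabilistically uniformly continuous' with respect to π_C, i.e., for every ε > 0 there exists δ > 0 such that d_B(b,b') < δ implies π_C({c : d_D(z(b,c), z(b',c)) < ε}) > 1 − ε. If the empirical measures ε(y_n(a), c) converge to π_B × π_C in probability (in the Prohorov metric) under (π_A × π_C)^n, then the pushforward empirical measures ε(y_n(a), c) ∘ z^{-1} converge to (π_B × π_C) ∘ z^{-1} in probability: for every ε > 0 and all large n, (π_A × π_C)^n({(a,c) : ρ_D(ε(y_n(a),c)∘z^{-1}, (π_B×π_C)∘z^{-1}) < ε}) > 1 − ε. -/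
open MeasureTheory Filter Topology
open scoped ENNReal

/-- Filter of events of asymptotically full probability. -/
def pFilter {E : ℕ → Type*} [∀ n, MeasurableSpace (E n)] (P : ∀ n, Measure (E n)) :
    Filter (Σ n, E n) where
  sets := {S | Tendsto (fun n => P n {x | (⟨n, x⟩ : Σ n, E n) ∉ S}) atTop (𝓝 0)}
  univ_sets := by simp
  sets_of_superset := by
    intro S T hS hST
    refine tendsto_of_tendsto_of_tendsto_of_le_of_le tendsto_const_nhds hS
      (fun n => zero_le) (fun n => measure_mono fun x hx hxS => hx (hST hxS))
  inter_sets := by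
    intro S T hS hT
    have := Tendsto.add hS hT
    rw [add_zero] at this
    refine tendsto_of_tendsto_of_tendsto_of_le_of_le tendsto_const_nhds this
      (fun n => zero_le) (fun n => ?_)
    refine le_trans (measure_mono ?_) (measure_union_le _ _)
    intro x hx
    by_contra hc
    simp only [Set.mem_union, Set.mem_setOf_eq, not_or, not_not] at hc
    exact hx ⟨hc.1, hc.2⟩

lemma mem_pFilter {E : ℕ → Type*} [∀ n, MeasurableSpace (E n)] (P : ∀ n, Measure (E n))
    (S : Set (Σ n, E n)) :
    S ∈ pFilter P ↔ Tendsto (fun n => P n {x | (⟨n, x⟩ : Σ n, E n) ∉ S}) atTop (𝓝 0) := Iff.rfl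

instance empProb {A : Type*} [MeasurableSpace A] {n : ℕ} (a : Fin (n + 1) → A) :
    IsProbabilityMeasure (empMeasure a) := by
  constructor
  simp only [empMeasure, Measure.smul_apply, Measure.finset_sum_apply, measure_univ,
    Finset.sum_const, Finset.card_univ, Fintype.card_fin, nsmul_eq_mul, mul_one, smul_eq_mul]
  exact ENNReal.inv_mul_cancel (by simp) (by finiteness)

lemma integral_emp {A : Type*} [MeasurableSpace A] {n : ℕ} (a : Fin n → A) (G : A → ℝ)
    (hG : Measurable G) : ∫ x, G x ∂(empMeasure a) = (n : ℝ)⁻¹ * ∑ m, G (a m) := by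
  rw [empMeasure, integral_smul_measure, integral_finset_sum_measure]
  · simp [integral_dirac' _ _ hG.stronglyMeasurable]
  · intro i _
    exact integrable_dirac' hG.stronglyMeasurable (by simp)

lemma contF {B C D : Type*} [MetricSpace B] [MeasurableSpace B] [MeasurableSpace C]
    [MetricSpace D] [SecondCountableTopology D] [MeasurableSpace D] [BorelSpace D]
    (πC : Measure C) [IsProbabilityMeasure πC]
    (z : B × C → D) (hzm : Measurable z)
    (hz : ∀ ε > (0 : ℝ), ∃ δ > (0 : ℝ), ∀ b b' : B, dist b b' < δ →
      (πC {c : C | dist (z (b, c)) (z (b', c)) < ε}).toReal > 1 - ε)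
    (f : BoundedContinuousFunction D ℝ) : Continuous fun b => ∫ c, f (z (b, c)) ∂πC := by
  have hzb : ∀ b, Measurable fun c => z (b, c) := fun b => hzm.comp measurable_prodMk_left
  refine SeqContinuous.continuous ?_
  intro u b hu
  refine tendsto_of_subseq_tendsto fun ns hns => ?_
  have hT : TendstoInMeasure πC (fun k c => z (u (ns k), c)) atTop (fun c => z (b, c)) := by
    rw [tendstoInMeasure_iff_measureReal_dist]
    intro ε hε
    rw [Metric.tendsto_atTop]
    intro η hη
    obtain ⟨δ, hδ, H⟩ := hz (min ε η) (lt_min hε hη)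
    obtain ⟨N, hN⟩ := Metric.tendsto_atTop.1 (hu.comp hns) δ hδ
    refine ⟨N, fun k hk => ?_⟩
    have h1 := H _ _ (hN k hk)
    have hms : MeasurableSet {c : C | dist (z (u (ns k), c)) (z (b, c)) < min ε η} :=
      measurableSet_lt ((hzb _).dist (hzb _)) measurable_const
    have h2 := probReal_compl_eq_one_sub (μ := πC) hms
    have h3 : πC.real {x | ε ≤ dist (z (u (ns k), x)) (z (b, x))} ≤
        πC.real {c : C | dist (z (u (ns k), c)) (z (b, c)) < min ε η}ᶜ := by
      refine measureReal_mono fun c hc => ?_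
      simp only [Set.mem_compl_iff, Set.mem_setOf_eq, not_lt] at hc ⊢
      exact (min_le_left _ _).trans hc
    have h4 : πC.real {c : C | dist (z (u (ns k), c)) (z (b, c)) < min ε η} > 1 - min ε η := h1
    rw [Real.dist_eq, sub_zero, abs_of_nonneg measureReal_nonneg]
    have := min_le_right ε η
    linarith
  obtain ⟨ms, hms, hae⟩ := hT.exists_seq_tendsto_ae
  refine ⟨ms, ?_⟩
  refine tendsto_integral_of_dominated_convergence (fun _ => ‖f‖) ?_ (integrable_const _) ?_ ?_
  · intro k
    exact (f.continuous.measurable.comp (hzb _)).aestronglyMeasurable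
  · intro k
    exact ae_of_all _ fun c => f.norm_coe_le_norm _
  · filter_upwards [hae] with c hc
    exact (f.continuous.tendsto _).comp hc

lemma cheb {C : Type*} [MeasurableSpace C] (πC : Measure C) [IsProbabilityMeasure πC]
    {n : ℕ} (g : Fin (n + 1) → C → ℝ) (hg : ∀ m, Measurable (g m)) (M : ℝ)
    (hM : ∀ m c, |g m c| ≤ M) (η : ℝ) (hη : 0 < η) :
    (Measure.pi fun _ : Fin (n + 1) => πC)
      {c | η ≤ |((n + 1 : ℕ) : ℝ)⁻¹ * ∑ m, (g m (c m) - ∫ x, g m x ∂πC)|} ≤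
      ENNReal.ofReal (M ^ 2 / η ^ 2 / ((n : ℝ) + 1)) := by
  have hL : ∀ m, MemLp (g m) 2 πC := fun m =>
    MemLp.of_bound (hg m).aestronglyMeasurable M (ae_of_all _ fun c => hM m c)
  have hLp : ∀ m, MemLp (fun c : Fin (n + 1) → C => g m (c m)) 2
      (Measure.pi fun _ : Fin (n + 1) => πC) := fun m =>
    (hL m).comp_measurePreserving (measurePreserving_eval (fun _ : Fin (n + 1) => πC) m)
  have hv := ProbabilityTheory.variance_sum_pi (μ := fun _ : Fin (n + 1) => πC) hL
  have hS : MemLp (∑ m, fun c : Fin (n + 1) → C => g m (c m)) 2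
      (Measure.pi fun _ : Fin (n + 1) => πC) := memLp_finset_sum' _ fun m _ => hLp m
  have hn : (0 : ℝ) < (n : ℝ) + 1 := by positivity
  have key := ProbabilityTheory.meas_ge_le_variance_div_sq hS (c := η * ((n : ℝ) + 1))
    (by positivity)
  have hE : ∫ c, (∑ m, fun c : Fin (n + 1) → C => g m (c m)) c
      ∂(Measure.pi fun _ : Fin (n + 1) => πC) = ∑ m, ∫ x, g m x ∂πC := by
    simp only [Finset.sum_apply]
    rw [integral_finset_sum _ fun m _ => (hLp m).integrable (by norm_num)]
    refine Finset.sum_congr rfl fun m _ => ?_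
    exact integral_comp_eval (μ := fun _ : Fin (n + 1) => πC) (i := m)
      (hg m).aestronglyMeasurable
  rw [hE, hv] at key
  refine le_trans (le_of_eq ?_) (key.trans (ENNReal.ofReal_le_ofReal ?_))
  · congr 1
    ext c
    simp only [Set.mem_setOf_eq, Finset.sum_apply, Finset.sum_sub_distrib, abs_mul, abs_inv]
    push_cast
    rw [abs_of_pos hn, inv_mul_eq_div, le_div_iff₀ hn]
  · have hvb : ∀ m, ProbabilityTheory.variance (g m) πC ≤ M ^ 2 := fun m => by
      have := ProbabilityTheory.variance_le_sq_of_bounded (μ := πC) (a := -M) (b := M)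
        (X := g m) (ae_of_all _ fun c => abs_le.1 (hM m c)) (hg m).aemeasurable
      refine this.trans (le_of_eq (by ring))
    have : ∑ m : Fin (n + 1), ProbabilityTheory.variance (g m) πC ≤ ((n : ℝ) + 1) * M ^ 2 := by
      refine (Finset.sum_le_sum fun m _ => hvb m).trans (le_of_eq ?_)
      simp
    calc _ ≤ ((n : ℝ) + 1) * M ^ 2 / (η * ((n : ℝ) + 1)) ^ 2 := by gcongr
      _ = _ := by field_simp

/-- `ProbabilityMeasure` version of the empirical measure. -/
noncomputable def empP {A : Type*} [MeasurableSpace A] {n : ℕ} (a : Fin (n + 1) → A) :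
    ProbabilityMeasure A := ⟨empMeasure a, inferInstance⟩

lemma measLP {A : Type*} [MetricSpace A] [SecondCountableTopology A] [MeasurableSpace A]
    [BorelSpace A] (n : ℕ) (π : ProbabilityMeasure A) (ρ : ℝ) :
    MeasurableSet {a : Fin (n + 1) → A | levyProkhorovDist (empMeasure a) (π : Measure A) < ρ} := by
  have h1 : Continuous fun a : Fin (n + 1) → A => empP a := by
    rw [ProbabilityMeasure.continuous_iff_forall_continuous_integral]
    intro f
    have : (fun a : Fin (n + 1) → A => ∫ x, f x ∂(empP a : Measure A)) =
        fun a => ((n + 1 : ℕ) : ℝ)⁻¹ * ∑ m, f (a m) := by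
      ext a
      exact integral_emp a f f.continuous.measurable
    rw [this]
    fun_prop
  have h2 : Continuous fun a : Fin (n + 1) → A => LevyProkhorov.ofMeasure (empP a) :=
    LevyProkhorov.continuous_ofMeasure_probabilityMeasure.comp h1
  have h3 : Continuous fun a : Fin (n + 1) → A =>
      dist (LevyProkhorov.ofMeasure (empP a)) (LevyProkhorov.ofMeasure π) :=
    h2.dist continuous_const
  exact (isOpen_lt h3 continuous_const).measurableSet

/-- If the joint empirical measures `ε(y_n(a), c)` converge to `π_B × π_C` in probability
and `z : B × C → D` is probabilistically uniformly continuous with respect to `π_C`, then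
the pushforward empirical measures `ε(y_n(a), c) ∘ z⁻¹` converge to
`(π_B × π_C) ∘ z⁻¹` in probability. -/
theorem stmt_7 {A B C D : Type*}
    [MetricSpace A] [TopologicalSpace.SeparableSpace A] [MeasurableSpace A] [BorelSpace A]
    [MetricSpace B] [TopologicalSpace.SeparableSpace B] [MeasurableSpace B] [BorelSpace B]
    [MetricSpace C] [TopologicalSpace.SeparableSpace C] [MeasurableSpace C] [BorelSpace C]
    [MetricSpace D] [TopologicalSpace.SeparableSpace D] [MeasurableSpace D] [BorelSpace D]
    (y : (n : ℕ) → (Fin n → A) → (Fin n → B)) (hy : ∀ n, Measurable (y n))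
    (πA : Measure A) (πB : Measure B) (πC : Measure C)
    [IsProbabilityMeasure πA] [IsProbabilityMeasure πB] [IsProbabilityMeasure πC]
    (z : B × C → D) (hzm : Measurable z)
    (hz : ∀ ε > (0 : ℝ), ∃ δ > (0 : ℝ), ∀ b b' : B, dist b b' < δ →
      (πC {c : C | dist (z (b, c)) (z (b', c)) < ε}).toReal > 1 - ε)
    (h : ∀ ε > (0 : ℝ), ∃ N : ℕ, ∀ n ≥ N,
      ((Measure.pi fun _ : Fin n => πA.prod πC)
        {ac : Fin n → A × C |
          levyProkhorovDist
            (empMeasure (fun m : Fin n => ((y n fun m' => (ac m').1) m, (ac m).2)))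
            (πB.prod πC) < ε}).toReal > 1 - ε) :
    ∀ ε > (0 : ℝ), ∃ N : ℕ, ∀ n ≥ N,
      ((Measure.pi fun _ : Fin n => πA.prod πC)
        {ac : Fin n → A × C |
          levyProkhorovDist
            ((empMeasure
              (fun m : Fin n => ((y n fun m' => (ac m').1) m, (ac m).2))).map z)
            ((πB.prod πC).map z) < ε}).toReal > 1 - ε := by
  have : SecondCountableTopology B := UniformSpace.secondCountable_of_separable B
  have : SecondCountableTopology C := UniformSpace.secondCountable_of_separable C
  have : SecondCountableTopology D := UniformSpace.secondCountable_of_separable D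
  let P : ∀ n : ℕ, Measure (Fin (n + 1) → A × C) := fun n =>
    Measure.pi fun _ : Fin (n + 1) => πA.prod πC
  let X : ∀ n : ℕ, (Fin n → A × C) → (Fin n → B × C) := fun n ac m =>
    ((y n fun m' => (ac m').1) m, (ac m).2)
  have hX : ∀ n, Measurable (X n) := by
    intro n
    refine measurable_pi_lambda _ fun m => ?_
    have := hy n
    refine Measurable.prodMk ?_ (by fun_prop)
    exact (measurable_pi_apply m).comp (this.comp (by fun_prop))
  let L : Filter (Σ n : ℕ, (Fin (n + 1) → A × C)) := pFilter P
  let π : ProbabilityMeasure (B × C) := ⟨πB.prod πC, inferInstance⟩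
  -- convergence of empirical measures
  have T1 : Tendsto (fun s : Σ n : ℕ, (Fin (n + 1) → A × C) => empP (X (s.1 + 1) s.2)) L (𝓝 π) := by
    have T0 : Tendsto (fun s : Σ n : ℕ, (Fin (n + 1) → A × C) =>
        LevyProkhorov.ofMeasure (empP (X (s.1 + 1) s.2))) L (𝓝 (LevyProkhorov.ofMeasure π)) := by
      rw [Metric.tendsto_nhds]
      intro ρ hρ
      refine (mem_pFilter P _).2 ?_
      rw [ENNReal.tendsto_nhds_zero]
      intro η hη
      obtain ⟨η', hη'0, hη'⟩ : ∃ η' : ℝ, 0 < η' ∧ ENNReal.ofReal η' ≤ η := by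
        refine ⟨(min η 1).toReal, ENNReal.toReal_pos (by simp [hη.ne']) (by simp), ?_⟩
        rw [ENNReal.ofReal_toReal (by simp)]
        exact min_le_left _ _
      obtain ⟨N, hN⟩ := h (min ρ η') (lt_min hρ hη'0)
      filter_upwards [eventually_ge_atTop N] with n hn
      have h1 := hN (n + 1) (by omega)
      have hms : MeasurableSet {ac : Fin (n + 1) → A × C |
          levyProkhorovDist (empMeasure (X (n + 1) ac)) (πB.prod πC) < min ρ η'} :=
        hX (n + 1) (measLP n π (min ρ η'))
      have h2 := probReal_compl_eq_one_sub (μ := P n) hms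
      have h4 : (P n).real {ac : Fin (n + 1) → A × C |
          levyProkhorovDist (empMeasure (X (n + 1) ac)) (πB.prod πC) < min ρ η'}
            > 1 - min ρ η' := h1
      have h5 : (P n).real {ac : Fin (n + 1) → A × C |
          levyProkhorovDist (empMeasure (X (n + 1) ac)) (πB.prod πC) < min ρ η'}ᶜ ≤ η' := by
        have := min_le_right ρ η'
        linarith
      refine le_trans (measure_mono ?_) (le_trans (ENNReal.le_ofReal_iff_toReal_le
        (measure_ne_top _ _) hη'0.le |>.2 h5) hη')
      intro ac hac hlt
      exact hac (lt_of_lt_of_le hlt (min_le_left _ _))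
    exact (LevyProkhorov.continuous_toMeasure_probabilityMeasure.tendsto _).comp T0
  have hmp : ∀ n (a : Fin (n + 1) → B × C), IsProbabilityMeasure ((empMeasure a).map z) :=
    fun n a => Measure.isProbabilityMeasure_map hzm.aemeasurable
  let ν : (Σ n : ℕ, (Fin (n + 1) → A × C)) → ProbabilityMeasure D := fun s =>
    ⟨(empMeasure (X (s.1 + 1) s.2)).map z, hmp _ _⟩
  let μ : ProbabilityMeasure D :=
    ⟨(πB.prod πC).map z, Measure.isProbabilityMeasure_map hzm.aemeasurable⟩
  have T2 : Tendsto ν L (𝓝 μ) := by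
    rw [ProbabilityMeasure.tendsto_iff_forall_integral_tendsto]
    intro f
    have hfm : Measurable f := f.continuous.measurable
    have hFc := contF πC z hzm hz f
    set F : B → ℝ := fun b => ∫ c, f (z (b, c)) ∂πC with hF
    have hFb : ∀ b, ‖F b‖ ≤ ‖f‖ := fun b => by
      have := norm_integral_le_of_norm_le_const (μ := πC) (f := fun c => f (z (b, c)))
        (ae_of_all _ fun c => f.norm_coe_le_norm (z (b, c)))
      simpa using this
    let G : BoundedContinuousFunction (B × C) ℝ :=
      BoundedContinuousFunction.ofNormedAddCommGroup (fun p => F p.1) (hFc.comp continuous_fst) ‖f‖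
        (fun p => hFb p.1)
    have T3 := ProbabilityMeasure.tendsto_iff_forall_integral_tendsto.1 T1 G
    have hlim : ∫ p, G p ∂(π : Measure (B × C)) = ∫ d, f d ∂(μ : Measure D) := by
      change ∫ p, F p.1 ∂(πB.prod πC) = ∫ d, f d ∂((πB.prod πC).map z)
      rw [integral_map hzm.aemeasurable hfm.aestronglyMeasurable]
      have hi : Integrable (fun p => f (z p)) (πB.prod πC) :=
        Integrable.of_bound (hfm.comp hzm).aestronglyMeasurable ‖f‖
          (ae_of_all _ fun p => f.norm_coe_le_norm _)
      rw [integral_prod _ hi, integral_fun_fst F]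
      simp [hF]
    rw [hlim] at T3
    have hgm : Measurable fun p : B × C => f (z p) - F p.1 :=
      (hfm.comp hzm).sub (hFc.measurable.comp measurable_fst)
    have T4 : Tendsto (fun s : Σ n : ℕ, (Fin (n + 1) → A × C) =>
        ((s.1 + 1 : ℕ) : ℝ)⁻¹ * ∑ m, (f (z (X (s.1 + 1) s.2 m)) - F (X (s.1 + 1) s.2 m).1))
        L (𝓝 0) := by
      rw [Metric.tendsto_nhds]
      intro η hη
      refine (mem_pFilter P _).2 ?_
      have hto : Tendsto (fun n : ℕ => ENNReal.ofReal (‖f‖ ^ 2 / η ^ 2 / ((n : ℝ) + 1))) atTop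
          (𝓝 0) := by
        rw [← ENNReal.ofReal_zero]
        refine ENNReal.tendsto_ofReal ?_
        exact tendsto_const_nhds.div_atTop
          (tendsto_atTop_add_const_right _ _ tendsto_natCast_atTop_atTop)
      refine tendsto_of_tendsto_of_tendsto_of_le_of_le tendsto_const_nhds hto
        (fun n => zero_le) (fun n => ?_)
      let S : Set ((Fin (n + 1) → A) × (Fin (n + 1) → C)) :=
        {p | η ≤ |((n + 1 : ℕ) : ℝ)⁻¹ * ∑ m, (f (z (y (n + 1) p.1 m, p.2 m))
          - F (y (n + 1) p.1 m))|}
      have hS : MeasurableSet S := by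
        refine measurableSet_le measurable_const (Measurable.abs (Measurable.const_mul ?_ _))
        refine Finset.measurable_sum _ fun m _ => ?_
        refine hgm.comp (Measurable.prodMk ?_ ?_)
        · exact (measurable_pi_apply m).comp ((hy _).comp measurable_fst)
        · exact (measurable_pi_apply m).comp measurable_snd
      have hpre := (measurePreserving_arrowProdEquivProdArrow A C (Fin (n + 1))
        (fun _ => πA) (fun _ => πC)).measure_preimage hS.nullMeasurableSet
      have hle : (P n) ((MeasurableEquiv.arrowProdEquivProdArrow A C (Fin (n + 1))) ⁻¹' S) ≤
          ENNReal.ofReal (‖f‖ ^ 2 / η ^ 2 / ((n : ℝ) + 1)) := by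
        refine hpre.trans_le ?_
        rw [Measure.prod_apply hS]
        refine (lintegral_mono (g := fun _ =>
          ENNReal.ofReal (‖f‖ ^ 2 / η ^ 2 / ((n : ℝ) + 1))) fun a => ?_).trans (by simp)
        exact cheb πC (fun m c => f (z (y (n + 1) a m, c)))
          (fun m => hfm.comp (hzm.comp measurable_prodMk_left)) ‖f‖
          (fun m c => f.norm_coe_le_norm _) η hη
      refine le_trans (measure_mono ?_) hle
      intro ac hac
      simp only [Set.mem_setOf_eq, Real.dist_eq, sub_zero, not_lt] at hac
      exact hac
    have T5 := T3.add T4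
    rw [add_zero] at T5
    refine T5.congr fun s => ?_
    change ∫ p, F p.1 ∂(empMeasure (X (s.1 + 1) s.2)) + _ =
      ∫ d, f d ∂((empMeasure (X (s.1 + 1) s.2)).map z)
    rw [integral_map hzm.aemeasurable hfm.aestronglyMeasurable,
      integral_emp _ (fun p : B × C => F p.1) (hFc.measurable.comp measurable_fst),
      integral_emp _ (fun p : B × C => f (z p)) (hfm.comp hzm), ← mul_add, ← Finset.sum_add_distrib]
    simp
  intro ε hε
  have T6 := (LevyProkhorov.continuous_ofMeasure_probabilityMeasure.tendsto μ).comp T2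
  have T7 := (mem_pFilter P _).1 (Metric.tendsto_nhds.1 T6 ε hε)
  obtain ⟨N, hN⟩ := eventually_atTop.1
    (T7.eventually_lt_const (ENNReal.ofReal_pos.2 hε))
  refine ⟨N + 1, fun n hn => ?_⟩
  obtain ⟨k, rfl⟩ : ∃ k, n = k + 1 := ⟨n - 1, by omega⟩
  have h1 := hN k (by omega)
  set S : Set (Fin (k + 1) → A × C) := {ac | levyProkhorovDist
    ((empMeasure (fun m : Fin (k + 1) => ((y (k + 1) fun m' => (ac m').1) m, (ac m).2))).map z)
            ((πB.prod πC).map z) < ε} with hSdef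
  have h2 : (P k) Sᶜ < ENNReal.ofReal ε := h1
  have h3 : (P k).real Sᶜ < ε := (ENNReal.lt_ofReal_iff_toReal_lt (measure_ne_top _ _)).1 h2
  have h4 := measureReal_union_le (μ := P k) S Sᶜ
  rw [Set.union_compl_self, probReal_univ] at h4
  change (P k).real S > 1 - ε
  linarith
end
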